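/- arXiv:2005.13821 — 7 statements merged into one kernel-verified Lean document; each statement's English description precedes it below -/
import Mathlib

section
/- The formal power series $M(z) = \sum_{n\ge 1} \frac{3\cdot 6^n}{(n+2)(n+1)}\binom{2n}{n}\, z^n$ in $\mathbb{Q}[[z]]$ satisfies the quadratic equation $72\,z^2 M(z)^2 + (216\,z^2 - 36\,z + 1)\,M(z) + 162\,z^2 - 6\,z = 0$, and moreover it is the unique formal power series in $\mathbb{Q}[[z]]$ satisfying this equation. -/
open PowerSeries

/-- The generating function of rooted cubic planar maps with a distinguished
perfect matching: `M_n = 3·6^n/((n+2)(n+1))·C(2n,n)` for `n ≥ 1`, `M_0 = 0`. -/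
noncomputable def Mgf : PowerSeries ℚ :=
  PowerSeries.mk fun n =>
    if n = 0 then 0
    else (3 * 6 ^ n * (Nat.choose (2 * n) n) : ℚ) / ((n + 2) * (n + 1))

/-- The Catalan generating function over `ℚ`, evaluated at `6 z`. -/
noncomputable def catalanSix : PowerSeries ℚ :=
  rescale 6 (PowerSeries.map (Nat.castRingHom ℚ) catalanSeries)

theorem coeff_catalanSix (n : ℕ) : coeff n catalanSix = 6 ^ n * (catalan n : ℚ) := by
  simp [catalanSix, coeff_rescale]

theorem catalanSix_eq : 6 * X * catalanSix ^ 2 + 1 = catalanSix := by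
  have h := congrArg (fun f => rescale (6 : ℚ) (PowerSeries.map (Nat.castRingHom ℚ) f))
    catalanSeries_sq_mul_X_add_one
  simp only [map_add, map_mul, map_pow, map_one, PowerSeries.map_X, rescale_X, map_ofNat] at h
  rw [catalanSix]
  linear_combination h

theorem cast_catalan_succ (n : ℕ) :
    ((n : ℚ) + 2) * catalan (n + 1) = 2 * (2 * n + 1) * catalan n := by
  have h1 : ((n : ℚ) + 1) * catalan n = n.centralBinom := by
    exact_mod_cast succ_mul_catalan_eq_centralBinom n
  have h2 : ((n : ℚ) + 1 + 1) * catalan (n + 1) = (n + 1).centralBinom := by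
    exact_mod_cast succ_mul_catalan_eq_centralBinom (n + 1)
  have h3 : ((n : ℚ) + 1) * (n + 1).centralBinom = 2 * (2 * n + 1) * n.centralBinom := by
    exact_mod_cast Nat.succ_mul_centralBinom_succ n
  have hn : (n : ℚ) + 1 ≠ 0 := by positivity
  apply mul_left_cancel₀ hn
  linear_combination (n + 1 : ℚ) * h2 + h3 - 2 * (2 * n + 1 : ℚ) * h1

theorem coeff_Mgf_succ (n : ℕ) :
    coeff (n + 1) Mgf = 3 * 6 ^ (n + 1) * (catalan (n + 1) : ℚ) / (n + 3) := by
  have h : ((n : ℚ) + 1 + 1) * catalan (n + 1) = (Nat.choose (2 * (n + 1)) (n + 1) : ℚ) := by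
    exact_mod_cast succ_mul_catalan_eq_centralBinom (n + 1)
  rw [Mgf, coeff_mk, if_neg n.succ_ne_zero, ← h]
  push_cast
  field_simp
  ring

theorem twelve_X_mul_Mgf :
    X * (12 * Mgf) = 1 - 18 * X - catalanSix + X * (24 * catalanSix) := by
  have c (a : ℕ) [a.AtLeastTwo] : (OfNat.ofNat a : PowerSeries ℚ) = C (OfNat.ofNat a : ℚ) :=
    (map_ofNat C a).symm
  ext n
  rcases n with _ | _ | n
  · have h0 : constantCoeff catalanSix = 1 := by
      simpa using coeff_catalanSix 0
    simp [h0]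
  · simp only [map_add, map_sub, coeff_succ_X_mul, c,
      coeff_C_mul, coeff_catalanSix, coeff_one, coeff_X]
    norm_num [Mgf]
  · have h := cast_catalan_succ (n + 1)
    simp only [map_add, map_sub, coeff_succ_X_mul, c,
      coeff_C_mul, coeff_catalanSix, coeff_one, coeff_X, coeff_Mgf_succ]
    push_cast at h
    have hn : (n : ℚ) + 3 ≠ 0 := by positivity
    simp
    field_simp
    linear_combination (6 ^ (n + 2) : ℚ) * h

/-- `M(z)` satisfies `72 z² M² + (216 z² - 36 z + 1) M + 162 z² - 6 z = 0`, and it is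
the unique formal power series over `ℚ` satisfying this quadratic equation. -/
theorem stmt_0 :
    (72 * X ^ 2 * Mgf ^ 2 + (216 * X ^ 2 - 36 * X + 1) * Mgf
        + 162 * X ^ 2 - 6 * X = 0) ∧
    ∀ N : PowerSeries ℚ,
      72 * X ^ 2 * N ^ 2 + (216 * X ^ 2 - 36 * X + 1) * N
          + 162 * X ^ 2 - 6 * X = 0 → N = Mgf := by
  have hX : (12 * X : PowerSeries ℚ) ≠ 0 := mul_ne_zero
    (fun h => by
      have h0 := congrArg constantCoeff h
      rw [map_ofNat, map_zero] at h0
      norm_num at h0) X_ne_zero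
  have hM : 72 * X ^ 2 * Mgf ^ 2 + (216 * X ^ 2 - 36 * X + 1) * Mgf
      + 162 * X ^ 2 - 6 * X = 0 := by
    apply mul_left_cancel₀ hX
    have h1 := twelve_X_mul_Mgf
    have h2 := catalanSix_eq
    linear_combination (6 * X * (12 * X * Mgf + (1 - 18 * X - catalanSix + X * (24 * catalanSix)))
      + (216 * X ^ 2 - 36 * X + 1)) * h1 + (24 * X - 1) ^ 2 * h2
  refine ⟨hM, fun N hN => ?_⟩
  have h : (N - Mgf) * (72 * X ^ 2 * (N + Mgf) + (216 * X ^ 2 - 36 * X + 1)) = 0 := by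
    linear_combination hN - hM
  refine sub_eq_zero.mp ((mul_eq_zero.mp h).resolve_right fun h0 => ?_)
  simpa using congrArg constantCoeff h0
end

section
/- For every real number $z$ with $0 < |z| < 1/24$, the series $\sum_{n\ge 1} \frac{3\cdot 6^n}{(n+2)(n+1)}\binom{2n}{n}\, z^n$ converges and its sum equals $\frac{-1 + 36z - 216z^2 + (1-24z)^{3/2}}{144\,z^2}$. -/
/-- The recursion `(k + 1) * choose a (k + 1) = (a - k) * choose a k` for generalized binomial
coefficients over a field of characteristic zero. -/
theorem Ring.succ_mul_choose_succ {K : Type*} [Field K] [CharZero K] (a : K) (k : ℕ) :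
    ((k : K) + 1) * Ring.choose a (k + 1) = (a - k) * Ring.choose a k := by
  have hk : (k : K) + 1 ≠ 0 := by exact_mod_cast k.succ_ne_zero
  have hf : ((k.factorial : ℕ) : K) ≠ 0 := by exact_mod_cast k.factorial_ne_zero
  simp only [Ring.choose_eq_smul, descPochhammer_succ_right, Polynomial.smeval_mul,
    Nat.factorial_succ, smul_eq_mul, Nat.cast_mul, Nat.cast_add, Nat.cast_one]
  simp only [Polynomial.smeval_sub, Polynomial.smeval_X, Polynomial.smeval_natCast]
  field_simp
  simp

/-- The generalized binomial coefficient of `3 / 2` in terms of central binomial coefficients. -/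
theorem choose_three_halves_add_two_mul_pow (n : ℕ) :
    Ring.choose (3 / 2 : ℝ) (n + 2) * (-24) ^ (n + 2) =
      144 * ((3 * 6 ^ n * (Nat.choose (2 * n) n) : ℝ) / ((n + 2) * (n + 1))) := by
  induction n with
  | zero =>
    have h := Ring.succ_mul_choose_succ (3 / 2 : ℝ) 1
    norm_num [Ring.choose_one_right] at h ⊢
    linarith
  | succ n ih =>
    have h := Ring.succ_mul_choose_succ (3 / 2 : ℝ) (n + 2)
    have hc : ((n : ℝ) + 1) * (Nat.choose (2 * (n + 1)) (n + 1)) =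
        2 * (2 * n + 1) * (Nat.choose (2 * n) n) := by
      exact_mod_cast Nat.succ_mul_centralBinom_succ n
    push_cast at h ⊢
    have h1 : (n : ℝ) + 1 ≠ 0 := by positivity
    have h2 : (n : ℝ) + 2 ≠ 0 := by positivity
    have h3 : (n : ℝ) + 3 ≠ 0 := by positivity
    have e : Ring.choose (3 / 2 : ℝ) (n + 2 + 1) =
        (3 / 2 - (n + 2)) * Ring.choose (3 / 2 : ℝ) (n + 2) / (n + 3) := by
      rw [eq_div_iff h3]; linear_combination h
    have e' : ((Nat.choose (2 * (n + 1)) (n + 1) : ℕ) : ℝ) =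
        2 * (2 * n + 1) * (Nat.choose (2 * n) n) / (n + 1) := by
      rw [eq_div_iff h1]; linear_combination hc
    rw [show n + 1 + 2 = n + 2 + 1 by ring, e, e', pow_succ (-24 : ℝ) (n + 2)]
    have : (3 / 2 - ((n : ℝ) + 2)) * Ring.choose (3 / 2 : ℝ) (n + 2) / (n + 3) *
        ((-24) ^ (n + 2) * -24) = 12 * (2 * n + 1) / (n + 3) *
          (Ring.choose (3 / 2 : ℝ) (n + 2) * (-24) ^ (n + 2)) := by ring
    rw [this, ih, show (n : ℝ) + 1 + 2 = n + 3 by ring, show (n : ℝ) + 1 + 1 = n + 2 by ring]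
    field_simp
    ring

/-- For `0 < |z| < 1/24`, the series `∑_{n≥1} (3·6^n/((n+2)(n+1)))·C(2n,n)·zⁿ`
converges with sum `(-1 + 36z - 216z² + (1-24z)^{3/2}) / (144 z²)`. -/
theorem stmt_1 (z : ℝ) (hz : 0 < |z|) (hz' : |z| < 1 / 24) :
    HasSum
      (fun n : ℕ =>
        if n = 0 then 0
        else (3 * 6 ^ n * (Nat.choose (2 * n) n) : ℝ) / ((n + 2) * (n + 1)) * z ^ n)
      ((-1 + 36 * z - 216 * z ^ 2 + (1 - 24 * z) ^ ((3 : ℝ) / 2)) / (144 * z ^ 2)) := by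
  have hz0 : z ≠ 0 := abs_pos.mp hz
  have hmem : -24 * z ∈ Metric.eball (0 : ℝ) 1 := by
    rw [← ENNReal.ofReal_one, Metric.eball_ofReal]
    simp only [mem_ball_zero_iff, Real.norm_eq_abs, abs_mul]
    norm_num
    linarith
  have hsum : HasSum (fun n : ℕ => Ring.choose (3 / 2 : ℝ) n * (-24 * z) ^ n)
      ((1 - 24 * z) ^ ((3 : ℝ) / 2)) := by
    have h := (Real.one_add_rpow_hasFPowerSeriesOnBall_zero (a := 3 / 2)).hasSum hmem
    simpa [sub_eq_add_neg, binomialSeries, FormalMultilinearSeries.coeff_ofScalars, mul_comm]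
      using h
  have hcoeff (n : ℕ) : Ring.choose (3 / 2 : ℝ) (n + 3) * (-24 * z) ^ (n + 3) / (144 * z ^ 2) =
      (3 * 6 ^ (n + 1) * (Nat.choose (2 * (n + 1)) (n + 1)) : ℝ) /
        (((n + 1 : ℕ) + 2) * ((n + 1 : ℕ) + 1)) * z ^ (n + 1) := by
    rw [mul_pow, ← mul_assoc, choose_three_halves_add_two_mul_pow (n + 1)]
    field_simp
    ring
  rw [← hasSum_nat_add_iff' 1]
  have h := ((hasSum_nat_add_iff' 3).mpr hsum).div_const (144 * z ^ 2)
  simp only [hcoeff] at h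
  have h2 := Ring.succ_mul_choose_succ (3 / 2 : ℝ) 1
  norm_num [Ring.choose_one_right] at h2
  have h2' : Ring.choose (3 / 2 : ℝ) 2 = 3 / 8 := by linarith
  have hval : ((1 - 24 * z) ^ ((3 : ℝ) / 2) -
      ∑ i ∈ Finset.range 3, Ring.choose (3 / 2 : ℝ) i * (-24 * z) ^ i) / (144 * z ^ 2) =
      (-1 + 36 * z - 216 * z ^ 2 + (1 - 24 * z) ^ ((3 : ℝ) / 2)) / (144 * z ^ 2) := by
    simp only [Finset.sum_range_succ, Finset.sum_range_zero, Ring.choose_zero_right,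
      Ring.choose_one_right, h2']
    ring
  rw [hval] at h
  simpa using h
end

section
/- Let $C_n = \frac{2^{2n+1}\,(3n)!!}{(n+2)!\; n!!}$, where $k!! = k(k-2)(k-4)\cdots$ denotes the double factorial. Then $C_n$ is asymptotically $\frac{\sqrt{6}}{\sqrt{\pi}}\, n^{-5/2}\, (12\sqrt{3})^n$; that is, $\lim_{n\to\infty} C_n \cdot n^{5/2} \cdot (12\sqrt{3})^{-n} = \frac{\sqrt{6}}{\sqrt{\pi}}$. -/
open Filter Real Nat

theorem tendsto_atTop_of_even_odd {α : Type*} {f : ℕ → α} {l : Filter α}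
    (heven : Tendsto (fun n => f (2 * n)) atTop l)
    (hodd : Tendsto (fun n => f (2 * n + 1)) atTop l) : Tendsto f atTop l := by
  intro s hs
  obtain ⟨a, ha⟩ := eventually_atTop.1 (heven.eventually_mem hs)
  obtain ⟨b, hb⟩ := eventually_atTop.1 (hodd.eventually_mem hs)
  refine eventually_atTop.2 ⟨2 * a + 2 * b + 1, fun n hn => ?_⟩
  obtain ⟨k, rfl | rfl⟩ := Nat.even_or_odd' n
  · exact ha k (by omega)
  · exact hb k (by omega)

theorem factorial_mul_eq_stirlingSeq {k m : ℕ} (hk : 0 < k) (hm : 0 < m) :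
    ((k * m)! : ℝ) = Stirling.stirlingSeq (k * m) * √(2 * k) * √m * ((k : ℝ) ^ m) ^ k
      * (((m : ℝ) / exp 1) ^ m) ^ k := by
  have hk' : (0 : ℝ) < k := by exact_mod_cast hk
  have hm' : (0 : ℝ) < m := by exact_mod_cast hm
  have hpow : ((k * m : ℝ) / exp 1) ^ (k * m)
      = ((k : ℝ) ^ m) ^ k * (((m : ℝ) / exp 1) ^ m) ^ k := by
    rw [← mul_pow, ← mul_pow, ← pow_mul, mul_comm m k, mul_div_assoc]
  have hsqrt : √(2 * (k * m : ℝ)) = √(2 * k) * √m := by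
    rw [← mul_assoc, Real.sqrt_mul (by positivity)]
  rw [Stirling.stirlingSeq]
  push_cast
  rw [hpow, hsqrt]
  field_simp

theorem tendsto_stirlingSeq_mul {k : ℕ} (hk : 0 < k) :
    Tendsto (fun m => Stirling.stirlingSeq (k * m)) atTop (nhds √π) :=
  Stirling.tendsto_stirlingSeq_sqrt_pi.comp (tendsto_id.const_mul_atTop' hk)

theorem doubleFactorial_two_mul_add_one_mul (k : ℕ) :
    (2 * k + 1)‼ * (2 ^ k * k !) = (2 * k + 1)! := by
  rw [Nat.factorial_eq_mul_doubleFactorial, Nat.doubleFactorial_two_mul]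

theorem natCast_rpow_five_halves (n : ℕ) : (n : ℝ) ^ ((5 : ℝ) / 2) = (n : ℝ) ^ 2 * √n := by
  rcases n.eq_zero_or_pos with rfl | hn
  · simp
  · rw [Real.sqrt_eq_rpow, ← Real.rpow_natCast, ← Real.rpow_add (by exact_mod_cast hn)]
    norm_num

/-- The number of rooted cubic planar maps with `2 * n` vertices, divided by
`n ^ (-5 / 2) * (12 * √3) ^ n`. -/
noncomputable def normalizedCubicMapCount (n : ℕ) : ℝ :=
  (2 ^ (2 * n + 1) * (Nat.doubleFactorial (3 * n)) : ℝ)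
      / ((Nat.factorial (n + 2)) * (Nat.doubleFactorial n))
    * (n : ℝ) ^ ((5 : ℝ) / 2) * (((12 : ℝ) * √3) ^ n)⁻¹

theorem twelve_mul_sqrt_three_pow_two_mul (m : ℕ) :
    ((12 : ℝ) * √3) ^ (2 * m) = (2 ^ m) ^ 4 * (3 ^ m) ^ 3 := by
  rw [pow_mul, mul_pow, Real.sq_sqrt (by norm_num), pow_right_comm 2 m 4, pow_right_comm 3 m 3,
    ← mul_pow]
  norm_num

theorem normalizedCubicMapCount_two_mul {m : ℕ} (hm : 0 < m) :
    normalizedCubicMapCount (2 * m) = √6 * Stirling.stirlingSeq (3 * m)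
      / (Stirling.stirlingSeq (1 * m) * Stirling.stirlingSeq (2 * m))
      * ((2 / (2 + 2 * (m : ℝ)⁻¹)) * (2 / (2 + (m : ℝ)⁻¹))) := by
  have hm' : (0 : ℝ) < m := by exact_mod_cast hm
  have hs (k : ℕ) (hk : 0 < k) : 0 < Stirling.stirlingSeq (k * m) :=
    lt_of_lt_of_le (by positivity) (Stirling.sqrt_pi_le_stirlingSeq (by positivity))
  have h1 := hs 1 (by norm_num)
  have h2 := hs 2 (by norm_num)
  have f1 := factorial_mul_eq_stirlingSeq one_pos hm
  have f2 := factorial_mul_eq_stirlingSeq two_pos hm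
  have f3 := factorial_mul_eq_stirlingSeq three_pos hm
  have hw : 0 < ((m : ℝ) / exp 1) ^ m := by positivity
  have hx : 0 < √(m : ℝ) := by positivity
  have h4 : √(4 : ℝ) = 2 := by rw [show (4 : ℝ) = 2 ^ 2 by norm_num, Real.sqrt_sq (by norm_num)]
  rw [normalizedCubicMapCount, natCast_rpow_five_halves, twelve_mul_sqrt_three_pow_two_mul,
    show 3 * (2 * m) = 2 * (3 * m) by ring, Nat.doubleFactorial_two_mul,
    Nat.doubleFactorial_two_mul, Nat.factorial_succ, Nat.factorial_succ,
    show (m ! : ℕ) = (1 * m)! by rw [one_mul],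
    show (2 : ℝ) ^ (2 * (2 * m) + 1) = 2 * (2 ^ m) ^ 4 by
      rw [_root_.pow_succ', ← pow_mul]; ring_nf]
  push_cast
  rw [f1, f2, f3, Real.sqrt_mul (by norm_num : (0 : ℝ) ≤ 2) (m : ℝ),
    show (2 : ℝ) ^ (3 * m) = (2 ^ m) ^ 3 by rw [← pow_mul, mul_comm]]
  norm_num [h4]
  generalize ((m : ℝ) / exp 1) ^ m = w at *
  generalize √(m : ℝ) = x at *
  field_simp
  ring

theorem normalizedCubicMapCount_two_mul_add_one {m : ℕ} (hm : 0 < m) :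
    normalizedCubicMapCount (2 * m + 1) =
      Stirling.stirlingSeq (6 * m) * Stirling.stirlingSeq (1 * m)
        / (Stirling.stirlingSeq (3 * m) * Stirling.stirlingSeq (2 * m) ^ 2)
      * (((6 + (m : ℝ)⁻¹) * (2 + (m : ℝ)⁻¹)) / ((2 + 3 * (m : ℝ)⁻¹) * (2 + 2 * (m : ℝ)⁻¹))
        * √(2 + (m : ℝ)⁻¹) / √3) := by
  have hm' : (0 : ℝ) < m := by exact_mod_cast hm
  have hs (k : ℕ) (hk : 0 < k) : 0 < Stirling.stirlingSeq (k * m) :=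
    lt_of_lt_of_le (by positivity) (Stirling.sqrt_pi_le_stirlingSeq (by positivity))
  have h2 := hs 2 (by norm_num)
  have h3 := hs 3 (by norm_num)
  have f1 := factorial_mul_eq_stirlingSeq one_pos hm
  have f2 := factorial_mul_eq_stirlingSeq two_pos hm
  have f3 := factorial_mul_eq_stirlingSeq three_pos hm
  have f6 := factorial_mul_eq_stirlingSeq (k := 6) (by norm_num) hm
  have hw : 0 < ((m : ℝ) / exp 1) ^ m := by positivity
  have hx : 0 < √(m : ℝ) := by positivity
  have h4 : √(4 : ℝ) = 2 := by rw [show (4 : ℝ) = 2 ^ 2 by norm_num, Real.sqrt_sq (by norm_num)]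
  have h12 : √(12 : ℝ) = √2 * √6 := by rw [← Real.sqrt_mul (by norm_num)]; norm_num
  have hr2 : √(2 : ℝ) ^ 2 = 2 := Real.sq_sqrt (by norm_num)
  have hsqrt : √(2 * (m : ℝ) + 1) = √(2 + (m : ℝ)⁻¹) * √(m : ℝ) := by
    rw [← Real.sqrt_mul (by positivity)]
    congr 1
    field_simp
  have d1 : ((2 * m + 1)‼ : ℝ) = (2 * m + 1) * (2 * m)! / (2 ^ m * (1 * m)!) := by
    rw [eq_div_iff (by positivity)]
    have := doubleFactorial_two_mul_add_one_mul m
    rw [Nat.factorial_succ (2 * m)] at this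
    rw [one_mul]
    exact_mod_cast this
  have d3 : ((3 * (2 * m + 1))‼ : ℝ)
      = 3 * (2 * m + 1) * (6 * m + 1) * (6 * m)! / ((2 ^ m) ^ 3 * (3 * m)!) := by
    rw [eq_div_iff (by positivity)]
    have h := doubleFactorial_two_mul_add_one_mul (3 * m + 1)
    rw [show 2 * (3 * m + 1) + 1 = 3 * (2 * m + 1) by ring, Nat.factorial_succ (3 * m),
      show 3 * (2 * m + 1) = 6 * m + 1 + 1 + 1 by ring, Nat.factorial_succ, Nat.factorial_succ,
      Nat.factorial_succ, pow_succ, mul_comm 3 m, pow_mul, mul_comm m 3] at h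
    rw [show 3 * (2 * m + 1) = 6 * m + 1 + 1 + 1 by ring]
    have h' := congrArg (Nat.cast : ℕ → ℝ) h
    push_cast at h'
    have hne : (2 * (3 * m + 1) : ℝ) ≠ 0 := by positivity
    refine mul_left_cancel₀ hne ?_
    linear_combination h'
  rw [normalizedCubicMapCount, natCast_rpow_five_halves, d1, d3, pow_succ (12 * √3),
    twelve_mul_sqrt_three_pow_two_mul, Nat.factorial_succ, Nat.factorial_succ, Nat.factorial_succ,
    show (2 : ℝ) ^ (2 * (2 * m + 1) + 1) = 8 * (2 ^ m) ^ 4 by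
      rw [← pow_mul, show (8 : ℝ) = 2 ^ 3 by norm_num, ← pow_add]; ring_nf]
  push_cast
  rw [f1, f2, f3, f6, hsqrt,
    show ((6 : ℕ) : ℝ) ^ m = 2 ^ m * 3 ^ m by rw [← mul_pow]; norm_num]
  norm_num [h4, h12]
  generalize ((m : ℝ) / exp 1) ^ m = w at *
  generalize √(2 + (m : ℝ)⁻¹) = y at *
  generalize √(m : ℝ) = x at *
  field_simp
  simp only [hr2]
  ring

theorem tendsto_natCast_inv_const_add_mul (a b : ℝ) :
    Tendsto (fun m : ℕ => a + b * (m : ℝ)⁻¹) atTop (nhds a) := by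
  simpa using (tendsto_inv_atTop_nhds_zero_nat (𝕜 := ℝ)).const_mul b |>.const_add a

theorem tendsto_normalizedCubicMapCount_two_mul :
    Tendsto (fun m => normalizedCubicMapCount (2 * m)) atTop (nhds (√6 / √π)) := by
  have hpi : √π ≠ 0 := by positivity
  have hs := fun (k : ℕ) (hk : 0 < k) => tendsto_stirlingSeq_mul hk
  have hc := tendsto_natCast_inv_const_add_mul
  have h := ((hs 3 (by norm_num)).const_mul √6).div ((hs 1 one_pos).mul (hs 2 two_pos))
    (by positivity) |>.mul ((tendsto_const_nhds (x := (2 : ℝ)).div (hc 2 2)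
      (by norm_num)).mul (tendsto_const_nhds (x := (2 : ℝ)).div (hc 2 1) (by norm_num)))
  have hlim : √6 * √π / (√π * √π) * (2 / 2 * (2 / 2)) = √6 / √π := by field_simp
  rw [hlim] at h
  refine h.congr' ?_
  filter_upwards [eventually_gt_atTop 0] with m hm
  simp [normalizedCubicMapCount_two_mul hm]

theorem tendsto_normalizedCubicMapCount_two_mul_add_one :
    Tendsto (fun m => normalizedCubicMapCount (2 * m + 1)) atTop (nhds (√6 / √π)) := by
  have hpi : √π ≠ 0 := by positivity
  have hs := fun (k : ℕ) (hk : 0 < k) => tendsto_stirlingSeq_mul hk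
  have hc := tendsto_natCast_inv_const_add_mul
  have h := ((hs 6 (by norm_num)).mul (hs 1 one_pos)).div
    ((hs 3 three_pos).mul ((hs 2 two_pos).pow 2)) (by positivity) |>.mul
      (((((hc 6 1).mul (hc 2 1)).div ((hc 2 3).mul (hc 2 2)) (by norm_num)).mul
        (hc 2 1).sqrt).div_const √3)
  have hlim : √π * √π / (√π * √π ^ 2) * (6 * 2 / (2 * 2) * √2 / √3) = √6 / √π := by
    rw [show (6 : ℝ) = 2 * 3 by norm_num, Real.sqrt_mul (by norm_num)]
    have h3 : √(3 : ℝ) ^ 2 = 3 := Real.sq_sqrt (by norm_num)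
    field_simp
    rw [h3]
  rw [hlim] at h
  refine h.congr' ?_
  filter_upwards [eventually_gt_atTop 0] with m hm
  simp [normalizedCubicMapCount_two_mul_add_one hm]

/-- `C_n = 2^{2n+1}·(3n)‼/((n+2)!·n‼)` satisfies `C_n ∼ (√6/√π)·n^{-5/2}·(12√3)ⁿ`. -/
theorem stmt_4 :
    Tendsto
      (fun n : ℕ =>
        (2 ^ (2 * n + 1) * (Nat.doubleFactorial (3 * n)) : ℝ)
            / ((Nat.factorial (n + 2)) * (Nat.doubleFactorial n))
          * (n : ℝ) ^ ((5 : ℝ) / 2) * (((12 : ℝ) * Real.sqrt 3) ^ n)⁻¹)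
      atTop (nhds (Real.sqrt 6 / Real.sqrt π)) :=
  tendsto_atTop_of_even_odd tendsto_normalizedCubicMapCount_two_mul
    tendsto_normalizedCubicMapCount_two_mul_add_one
end

section
/- Let $B_n = \frac{3\cdot 2^{n-1}}{(2n+1)(n+1)}\binom{4n+2}{n}$ and $b_n = \frac{2^{n+1}}{(2n+2)(2n+1)}\binom{3n}{n}$. Then $\frac{B_n}{b_n}$ is asymptotically $\frac{16\sqrt{2}}{9}\left(\frac{1024}{729}\right)^n$; that is, $\lim_{n\to\infty} \frac{B_n}{b_n}\cdot\left(\frac{729}{1024}\right)^n = \frac{16\sqrt{2}}{9}$. -/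
open Filter Real

/-- Stirling's normalisation solved for the factorial. -/
theorem factorial_eq_stirlingSeq_mul {n : ℕ} (hn : n ≠ 0) :
    (n.factorial : ℝ) = Stirling.stirlingSeq n * (√(2 * n) * (n / exp 1) ^ n) := by
  have hn' : (0 : ℝ) < n := by exact_mod_cast Nat.pos_of_ne_zero hn
  rw [Stirling.stirlingSeq, div_mul_cancel₀]
  positivity

theorem factorial_quotient_eq_stirlingSeq {n : ℕ} (hn : n ≠ 0) :
    ((4 * n).factorial * (2 * n).factorial : ℝ) / ((3 * n).factorial : ℝ) ^ 2
        * ((729 : ℝ) / 1024) ^ n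
      = Stirling.stirlingSeq (4 * n) * Stirling.stirlingSeq (2 * n)
          / Stirling.stirlingSeq (3 * n) ^ 2 * (2 * √2 / 3) := by
  have hn' : (0 : ℝ) < n := by exact_mod_cast Nat.pos_of_ne_zero hn
  have hS : Stirling.stirlingSeq (3 * n) ≠ 0 := by
    rw [Stirling.stirlingSeq]
    positivity
  have hsqrt : √(2 * (4 * n : ℝ)) * √(2 * (2 * n : ℝ)) = 4 * √2 * n := by
    rw [← Real.sqrt_mul (by positivity),
      show 2 * (4 * n : ℝ) * (2 * (2 * n)) = 2 * (4 * n) ^ 2 by ring,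
      Real.sqrt_mul (by norm_num), Real.sqrt_sq (by positivity)]
    ring
  have hsq : √(2 * (3 * n : ℝ)) ^ 2 = 6 * n := by
    rw [Real.sq_sqrt (by positivity)]
    ring
  have hpow : (4 * n / exp 1 : ℝ) ^ (4 * n) * (2 * n / exp 1) ^ (2 * n) * (729 / 1024) ^ n
      = ((3 * n / exp 1) ^ (3 * n)) ^ 2 := by
    rw [pow_mul, pow_mul, pow_mul, ← mul_pow, ← mul_pow, pow_right_comm]
    congr 1
    field_simp
    norm_num
  rw [factorial_eq_stirlingSeq_mul (n := 4 * n) (by positivity),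
    factorial_eq_stirlingSeq_mul (n := 2 * n) (by positivity),
    factorial_eq_stirlingSeq_mul (n := 3 * n) (by positivity)]
  push_cast
  have hP : (3 * n / exp 1 : ℝ) ^ (3 * n) ≠ 0 := by positivity
  generalize (4 * n / exp 1 : ℝ) ^ (4 * n) = p at *
  generalize (2 * n / exp 1 : ℝ) ^ (2 * n) = q at *
  generalize (3 * n / exp 1 : ℝ) ^ (3 * n) = r at *
  rw [mul_pow, mul_pow, hsq, ← hpow]
  have h0 : p * q * (729 / 1024) ^ n ≠ 0 := hpow ▸ pow_ne_zero 2 hP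
  calc _ = Stirling.stirlingSeq (4 * n) * Stirling.stirlingSeq (2 * n)
          * (√(2 * (4 * n : ℝ)) * √(2 * (2 * n : ℝ))) * (p * q * (729 / 1024) ^ n)
          / (Stirling.stirlingSeq (3 * n) ^ 2 * (6 * n) * (p * q * (729 / 1024) ^ n)) := by
        ring
    _ = _ := by
        rw [mul_div_mul_right _ _ h0, hsqrt]
        field_simp
        ring

theorem choose_div_choose_eq_factorial_quotient (n : ℕ) :
    ((4 * n + 2).choose n : ℝ) / ((3 * n).choose n)
      = (4 * n + 2) * (4 * n + 1) / ((3 * n + 2) * (3 * n + 1))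
        * (((4 * n).factorial * (2 * n).factorial) / ((3 * n).factorial : ℝ) ^ 2) := by
  rw [Nat.cast_choose ℝ (show n ≤ 4 * n + 2 by lia), Nat.cast_choose ℝ (show n ≤ 3 * n by lia),
    show 4 * n + 2 - n = 3 * n + 2 by lia, show 3 * n - n = 2 * n by lia]
  simp only [Nat.factorial_succ]
  push_cast
  have h₁ := Nat.cast_ne_zero (R := ℝ).2 (Nat.factorial_ne_zero n)
  have h₂ := Nat.cast_ne_zero (R := ℝ).2 (Nat.factorial_ne_zero (2 * n))
  have h₃ := Nat.cast_ne_zero (R := ℝ).2 (Nat.factorial_ne_zero (3 * n))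
  field_simp
  ring

theorem tendsto_linear_quotient :
    Tendsto (fun n : ℕ => ((4 * n + 2) * (4 * n + 1) : ℝ) / ((3 * n + 2) * (3 * n + 1)))
      atTop (nhds (16 / 9)) := by
  have hinv : Tendsto (fun n : ℕ => ((n : ℝ))⁻¹) atTop (nhds 0) := tendsto_inv_atTop_nhds_zero_nat
  have h : Tendsto (fun n : ℕ => ((4 + 2 * (n : ℝ)⁻¹) * (4 + (n : ℝ)⁻¹))
      / ((3 + 2 * (n : ℝ)⁻¹) * (3 + (n : ℝ)⁻¹))) atTop
      (nhds (((4 + 2 * 0) * (4 + 0)) / ((3 + 2 * 0) * (3 + 0)))) :=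
    (((hinv.const_mul 2).const_add 4).mul (hinv.const_add 4)).div
      (((hinv.const_mul 2).const_add 3).mul (hinv.const_add 3)) (by norm_num)
  norm_num at h
  refine h.congr' ?_
  filter_upwards [eventually_gt_atTop 0] with n hn
  have hn' : (0 : ℝ) < n := by exact_mod_cast hn
  field_simp

/-- With `B_n = 3·2^{n-1}·C(4n+2,n)/((2n+1)(n+1))` and
`b_n = 2^{n+1}·C(3n,n)/((2n+2)(2n+1))`, the ratio `B_n/b_n` (the expected number
of perfect matchings in a random rooted bridgeless cubic planar map) satisfies
`B_n/b_n ∼ (16√2/9)·(1024/729)ⁿ`. -/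
theorem stmt_9 :
    Tendsto
      (fun n : ℕ =>
        ((3 * 2 ^ (n - 1) * (Nat.choose (4 * n + 2) n) : ℝ) / ((2 * n + 1) * (n + 1)))
          / ((2 ^ (n + 1) * (Nat.choose (3 * n) n) : ℝ) / ((2 * n + 2) * (2 * n + 1)))
          * ((729 : ℝ) / 1024) ^ n)
      atTop (nhds (16 * Real.sqrt 2 / 9)) := by
  have hmul (k : ℕ) (hk : 0 < k) :
      Tendsto (fun n : ℕ => Stirling.stirlingSeq (k * n)) atTop (nhds √π) :=
    Stirling.tendsto_stirlingSeq_sqrt_pi.comp (tendsto_id.const_mul_atTop' hk)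
  have hπ : √π ≠ 0 := by positivity
  have hlim := ((tendsto_linear_quotient.const_mul (3 / 2)).mul
    ((((hmul 4 (by norm_num)).mul (hmul 2 (by norm_num))).div ((hmul 3 (by norm_num)).pow 2)
      (pow_ne_zero 2 hπ)).mul_const (2 * √2 / 3)))
  rw [show 3 / 2 * (16 / 9) * (√π * √π / √π ^ 2 * (2 * √2 / 3)) = 16 * √2 / 9 by
    field_simp] at hlim
  refine hlim.congr' ?_
  filter_upwards [eventually_ne_atTop 0] with n hn
  have hratio : (3 * 2 ^ (n - 1) * ((4 * n + 2).choose n) : ℝ) / ((2 * n + 1) * (n + 1))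
      / ((2 ^ (n + 1) * ((3 * n).choose n) : ℝ) / ((2 * n + 2) * (2 * n + 1)))
      = 3 / 2 * (((4 * n + 2).choose n : ℝ) / ((3 * n).choose n)) := by
    obtain ⟨m, rfl⟩ := Nat.exists_eq_succ_of_ne_zero hn
    have hc : ((3 * m.succ).choose m.succ : ℝ) ≠ 0 :=
      Nat.cast_ne_zero.2 (Nat.choose_pos (by lia)).ne'
    rw [Nat.succ_sub_one, show m.succ + 1 = m + 2 by lia, pow_add]
    field_simp
  rw [Pi.div_apply, ← factorial_quotient_eq_stirlingSeq hn, hratio,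
    choose_div_choose_eq_factorial_quotient]
  ring
end

section
/- The polynomial $p(x) = 904x^8 + 7232x^6 - 11833x^4 - 45362x^2 + 3616$ has exactly one root in the real interval $(0.2796,\ 0.2797)$ and has no root in the interval $(0,\ 0.2796]$; in particular, its smallest positive real root $\sigma$ satisfies $0.2796 < \sigma < 0.2797$. -/
/-- The polynomial `904u⁴ + 7232u³ - 11833u² - 45362u + 3616` is strictly decreasing on `[0, 1]`. -/
theorem strictAntiOn_quartic :
    StrictAntiOn
      (fun u : ℝ => 904 * u ^ 4 + 7232 * u ^ 3 - 11833 * u ^ 2 - 45362 * u + 3616)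
      (Set.Icc 0 1) := by
  rintro u ⟨hu0, hu1⟩ v ⟨hv0, hv1⟩ huv
  have huu : u ^ 2 ≤ 1 := pow_le_one₀ hu0 hu1
  have hvv : v ^ 2 ≤ 1 := pow_le_one₀ hv0 hv1
  have huv1 : u * v ≤ 1 := mul_le_one₀ hu1 hv0 hv1
  have hcubic : (u + v) * (u ^ 2 + v ^ 2) ≤ 2 * 2 :=
    mul_le_mul (by linarith) (by linarith) (by positivity) (by norm_num)
  have hslope : 0 < 45362 + 11833 * (u + v) - 7232 * (u ^ 2 + u * v + v ^ 2)
      - 904 * ((u + v) * (u ^ 2 + v ^ 2)) := by linarith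
  have hprod := mul_pos (sub_pos.2 huv) hslope
  dsimp only
  linarith

/-- The polynomial `904x⁸ + 7232x⁶ - 11833x⁴ - 45362x² + 3616` is strictly decreasing
on `[0, 1]`. -/
theorem strictAntiOn_octic :
    StrictAntiOn
      (fun x : ℝ => 904 * x ^ 8 + 7232 * x ^ 6 - 11833 * x ^ 4 - 45362 * x ^ 2 + 3616)
      (Set.Icc 0 1) := by
  rintro x ⟨hx0, hx1⟩ y ⟨hy0, hy1⟩ hxy
  have h := strictAntiOn_quartic ⟨sq_nonneg x, pow_le_one₀ hx0 hx1⟩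
    ⟨sq_nonneg y, pow_le_one₀ hy0 hy1⟩ (pow_lt_pow_left₀ hxy hx0 two_ne_zero)
  simpa only [← pow_mul, Nat.reduceMul] using h

/-- The polynomial `904x⁸ + 7232x⁶ - 11833x⁴ - 45362x² + 3616` has exactly one
root in `(0.2796, 0.2797)` and no root in `(0, 0.2796]`; in particular its
smallest positive real root `σ` satisfies `0.2796 < σ < 0.2797`. -/
theorem stmt_13 :
    (∃! x : ℝ, x ∈ Set.Ioo (0.2796 : ℝ) 0.2797 ∧
      904 * x ^ 8 + 7232 * x ^ 6 - 11833 * x ^ 4 - 45362 * x ^ 2 + 3616 = 0) ∧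
    ∀ x : ℝ, x ∈ Set.Ioc (0 : ℝ) 0.2796 →
      904 * x ^ 8 + 7232 * x ^ 6 - 11833 * x ^ 4 - 45362 * x ^ 2 + 3616 ≠ 0 := by
  constructor
  · obtain ⟨x, hx, hroot⟩ := intermediate_value_Ioo' (a := (0.2796 : ℝ)) (b := 0.2797)
      (by norm_num)
      (f := fun x : ℝ => 904 * x ^ 8 + 7232 * x ^ 6 - 11833 * x ^ 4 - 45362 * x ^ 2 + 3616)
      (by fun_prop) (show (0 : ℝ) ∈ Set.Ioo _ _ by constructor <;> norm_num)
    refine ⟨x, ⟨hx, hroot⟩, fun y ⟨hy, hyroot⟩ => ?_⟩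
    have hsub : Set.Ioo (0.2796 : ℝ) 0.2797 ⊆ Set.Icc 0 1 := fun z hz =>
      ⟨by linarith [hz.1], by linarith [hz.2]⟩
    exact strictAntiOn_octic.injOn (hsub hy) (hsub hx) (hyroot.trans hroot.symm)
  · rintro x ⟨hx0, hx1⟩
    have hle := strictAntiOn_octic.antitoneOn ⟨hx0.le, by linarith⟩
      (show (0.2796 : ℝ) ∈ Set.Icc 0 1 by constructor <;> norm_num) hx1
    refine ne_of_gt (lt_of_lt_of_le ?_ hle)
    norm_num
end

section
/- Let $\sigma$ be the smallest positive real root of the polynomial $904x^8 + 7232x^6 - 11833x^4 - 45362x^2 + 3616$ and let $\rho$ be the smallest positive real root of the polynomial $729x^{12} + 17496x^{10} + 148716x^8 + 513216x^6 - 7293760x^4 + 279936x^2 + 46656$. Then $1.1415 < \frac{\rho}{\sigma} < 1.1416$. -/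
lemma quartic_pos {t : ℝ} (ht : 0 < t) (h : t ≤ 0.279634 ^ 2) :
    0 < 904 * t ^ 4 + 7232 * t ^ 3 - 11833 * t ^ 2 - 45362 * t + 3616 := by
  obtain ⟨a, ha⟩ : ∃ a : ℝ, a = 0.279634 ^ 2 := ⟨_, rfl⟩
  have hta : t ≤ a := ha ▸ h
  have ha1 : a ≤ 1 / 10 := by rw [ha]; norm_num
  have ht1 : t ≤ 1 / 10 := hta.trans ha1
  have ha0 : 0 < a := ht.trans_le hta
  have hpa : 0 < 904 * a ^ 4 + 7232 * a ^ 3 - 11833 * a ^ 2 - 45362 * a + 3616 := by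
    rw [ha]; norm_num
  have h2 : t ^ 2 + t * a + a ^ 2 ≤ 3 / 100 := by nlinarith
  have h3 : (t + a) * (t ^ 2 + a ^ 2) ≤ 1 := by
    have : t ^ 2 + a ^ 2 ≤ 1 := by nlinarith
    nlinarith [sq_nonneg t, sq_nonneg a]
  have hs : 0 ≤ 45362 + 11833 * (t + a) - 7232 * (t ^ 2 + t * a + a ^ 2)
      - 904 * ((t + a) * (t ^ 2 + a ^ 2)) := by linarith
  linarith [mul_nonneg (sub_nonneg.2 hta) hs]

lemma sextic_pos {t : ℝ} (ht : 0 < t) (h : t ≤ 0.319222 ^ 2) :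
    0 < 729 * t ^ 6 + 17496 * t ^ 5 + 148716 * t ^ 4 + 513216 * t ^ 3
      - 7293760 * t ^ 2 + 279936 * t + 46656 := by
  have h6 : 0 < t ^ 6 := by positivity
  have h5 : 0 < t ^ 5 := by positivity
  have h4 : 0 < t ^ 4 := by positivity
  have h3 : 0 < t ^ 3 := by positivity
  rcases le_total t (1 / 10) with h1 | h1
  · nlinarith
  · obtain ⟨a, ha⟩ : ∃ a : ℝ, a = 0.319222 ^ 2 := ⟨_, rfl⟩
    have hta : t ≤ a := ha ▸ h
    have ha1 : a ≤ 1 / 5 := by rw [ha]; norm_num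
    have ha0 : 0 < a := ht.trans_le hta
    have hqa : 0 < 729 * a ^ 6 + 17496 * a ^ 5 + 148716 * a ^ 4 + 513216 * a ^ 3
        - 7293760 * a ^ 2 + 279936 * a + 46656 := by
      rw [ha]; norm_num
    have hs3 : t ^ 2 + t * a + a ^ 2 ≤ 3 / 25 := by nlinarith
    have hs4 : (t + a) * (t ^ 2 + a ^ 2) ≤ 4 / 125 := by
      have : t ^ 2 + a ^ 2 ≤ 2 / 25 := by nlinarith
      nlinarith [sq_nonneg t, sq_nonneg a]
    have hs5 : t * ((t + a) * (t ^ 2 + a ^ 2)) + a ^ 4 ≤ 1 := by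
      have : a ^ 4 ≤ (1 / 5) ^ 4 := by gcongr
      have : 0 ≤ (t + a) * (t ^ 2 + a ^ 2) := by positivity
      nlinarith
    have hs6 : (t ^ 2 + t * a + a ^ 2) * (t ^ 3 + a ^ 3) ≤ 1 := by
      have h₁ : t ^ 3 ≤ (1 / 5) ^ 3 := by gcongr; linarith
      have h₂ : a ^ 3 ≤ (1 / 5) ^ 3 := by gcongr
      have : 0 ≤ t ^ 2 + t * a + a ^ 2 := by positivity
      nlinarith
    have hs : 0 ≤ 7293760 * (t + a) - 279936 - 513216 * (t ^ 2 + t * a + a ^ 2)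
        - 148716 * ((t + a) * (t ^ 2 + a ^ 2))
        - 17496 * (t * ((t + a) * (t ^ 2 + a ^ 2)) + a ^ 4)
        - 729 * ((t ^ 2 + t * a + a ^ 2) * (t ^ 3 + a ^ 3)) := by linarith
    linarith [mul_nonneg (sub_nonneg.2 hta) hs]

/-- A least positive root lies in any interval `(a, b]` such that `f` is positive on `(0, a]`
and nonpositive at `b`. -/
lemma IsLeast.mem_Ioc_of_pos_root {f : ℝ → ℝ} (hf : Continuous f) {a b r : ℝ}
    (hr : IsLeast {x : ℝ | 0 < x ∧ f x = 0} r) (ha : 0 < a) (hab : a ≤ b)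
    (hpos : ∀ x, 0 < x → x ≤ a → 0 < f x) (hb : f b ≤ 0) : r ∈ Set.Ioc a b := by
  constructor
  · by_contra! h
    exact (hpos r hr.1.1 h).ne' hr.1.2
  · obtain ⟨c, hc, hc0⟩ :=
      intermediate_value_Icc' hab hf.continuousOn ⟨hb, (hpos a ha le_rfl).le⟩
    exact (hr.2 ⟨ha.trans_le hc.1, hc0⟩).trans hc.2

/-- If `σ` is the smallest positive real root of
`904x⁸ + 7232x⁶ - 11833x⁴ - 45362x² + 3616` and `ρ` is the smallest positive real
root of `729x¹² + 17496x¹⁰ + 148716x⁸ + 513216x⁶ - 7293760x⁴ + 279936x² + 46656`,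
then `1.1415 < ρ/σ < 1.1416`. -/
theorem stmt_15 (σ ρ : ℝ)
    (hσ : IsLeast {x : ℝ | 0 < x ∧
      904 * x ^ 8 + 7232 * x ^ 6 - 11833 * x ^ 4 - 45362 * x ^ 2 + 3616 = 0} σ)
    (hρ : IsLeast {x : ℝ | 0 < x ∧
      729 * x ^ 12 + 17496 * x ^ 10 + 148716 * x ^ 8 + 513216 * x ^ 6
        - 7293760 * x ^ 4 + 279936 * x ^ 2 + 46656 = 0} ρ) :
    1.1415 < ρ / σ ∧ ρ / σ < 1.1416 := by
  obtain ⟨hσ₁, hσ₂⟩ := hσ.mem_Ioc_of_pos_root (a := 0.279634) (b := 0.279638)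
    (by fun_prop) (by norm_num) (by norm_num)
    (fun x hx h => by
      have := quartic_pos (pow_pos hx 2) (pow_le_pow_left₀ hx.le h 2)
      ring_nf at this ⊢
      exact this) (by norm_num)
  obtain ⟨hρ₁, hρ₂⟩ := hρ.mem_Ioc_of_pos_root (a := 0.319222) (b := 0.319227)
    (by fun_prop) (by norm_num) (by norm_num)
    (fun x hx h => by
      have := sextic_pos (pow_pos hx 2) (pow_le_pow_left₀ hx.le h 2)
      ring_nf at this ⊢
      exact this) (by norm_num)
  have hσ₀ : 0 < σ := hσ.1.1
  rw [lt_div_iff₀ hσ₀, div_lt_iff₀ hσ₀]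
  constructor <;> norm_num at * <;> linarith
end

section
/- Let $\sigma_b$ be the smallest positive real root of the polynomial $216x^6 + 864x^4 - 5587x^2 + 432$, and let $\alpha_b = \sqrt{\frac{3\sqrt{3}-5}{2}}$. Then $\frac{\alpha_b}{\sigma_b} > 1.119$. -/
/-- If `σ_b` is the smallest positive real root of `216x⁶ + 864x⁴ - 5587x² + 432`
and `α_b = √((3√3 - 5)/2)`, then `α_b/σ_b > 1.119`. -/
theorem stmt_16 (σb : ℝ)
    (hσ : IsLeast {x : ℝ | 0 < x ∧ 216 * x ^ 6 + 864 * x ^ 4 - 5587 * x ^ 2 + 432 = 0} σb) :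
    1.119 < Real.sqrt ((3 * Real.sqrt 3 - 5) / 2) / σb := by
  obtain ⟨⟨hpos, -⟩, hmin⟩ := hσ
  have hle : σb ≤ 0.27985 := by
    have hcont : ContinuousOn
        (fun x : ℝ => 216 * x ^ 6 + 864 * x ^ 4 - 5587 * x ^ 2 + 432)
        (Set.Icc 0.1 0.27985) := by fun_prop
    obtain ⟨x, hx, hroot⟩ := intermediate_value_Icc' (by norm_num) hcont
      (show (0 : ℝ) ∈ Set.Icc _ _ by constructor <;> norm_num)
    exact (hmin ⟨lt_of_lt_of_le (by norm_num) hx.1, hroot⟩).trans hx.2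
  have hsqrt : (1.73205 : ℝ) < √3 := Real.lt_sqrt_of_sq_lt (by norm_num)
  rw [lt_div_iff₀ hpos]
  calc 1.119 * σb ≤ 1.119 * 0.27985 := by gcongr
    _ < √((3 * √3 - 5) / 2) := Real.lt_sqrt_of_sq_lt (by norm_num at hsqrt ⊢; linarith)
end
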